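/- Let P be a finite bounded graded lattice of rank n with n ≤ 4. If P contains a global spindle of length less than 2π (a short global spindle), then n = 4, the spindle has girth exactly 6, and there is an r ∈ {1, 2} such that the ranks of the spindle elements alternate between r and r + 1 around the spindle. -/

import Mathlib

/-- `x` and `y` are complements in the interval `[z, w]`. -/
def ComplementsIn {P : Type*} [PartialOrder P] (z w x y : P) : Prop :=
  z ≤ x ∧ x ≤ w ∧ z ≤ y ∧ y ≤ w ∧
  (∀ u, z ≤ u → u ≤ w → x ≤ u → y ≤ u → u = w) ∧
  (∀ u, z ≤ u → u ≤ w → u ≤ x → u ≤ y → u = z)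

/-- A spindle of girth `2k` in the interval `[z, w]` (see the paper): a `2k`-periodic
sequence of elements of the interval, distinct over one period and distinct from the
endpoints, whose alternate members are complements in the appropriate subintervals.
A global spindle is the case `z = ⊥`, `w = ⊤`. -/
def IsSpindleIn {P : Type*} [PartialOrder P] (z w : P) (k : ℕ) (x : ℤ → P) : Prop :=
  2 ≤ k ∧
  (∀ i : ℤ, x (i + 2 * k) = x i) ∧
  (∀ i j : ℤ, 0 ≤ i → i < 2 * k → 0 ≤ j → j < 2 * k → x i = x j → i = j) ∧
  (∀ i : ℤ, z ≤ x i ∧ x i ≤ w ∧ x i ≠ z ∧ x i ≠ w) ∧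
  (((∀ i : ℤ, Even i → ComplementsIn z (x i) (x (i - 1)) (x (i + 1))) ∧
    (∀ i : ℤ, Odd i → ComplementsIn (x i) w (x (i - 1)) (x (i + 1)))) ∨
   ((∀ i : ℤ, Odd i → ComplementsIn z (x i) (x (i - 1)) (x (i + 1))) ∧
    (∀ i : ℤ, Even i → ComplementsIn (x i) w (x (i - 1)) (x (i + 1)))))

/-- The length, under the orthoscheme metric, of the edge of the diagonal link of a
graded lattice of rank `n` joining the vertices of two comparable elements `a`, `b`:
for `a < b` it is `arccos √((ρ a · (n − ρ b)) / (ρ b · (n − ρ a)))`; the meet and join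
are used to order the pair so that the smaller element comes first. -/
noncomputable def edgeLen {P : Type*} [Lattice P] (ρ : P → ℕ) (n : ℕ) (a b : P) : ℝ :=
  Real.arccos (Real.sqrt (((ρ (a ⊓ b) : ℝ) * ((n : ℝ) - (ρ (a ⊔ b) : ℝ))) /
    ((ρ (a ⊔ b) : ℝ) * ((n : ℝ) - (ρ (a ⊓ b) : ℝ)))))

/-- The length of a spindle of girth `2k`: the sum of the edge lengths over its `2k`
cyclically consecutive pairs. -/
noncomputable def spindleLength {P : Type*} [Lattice P] (ρ : P → ℕ) (n k : ℕ)
    (x : ℤ → P) : ℝ :=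
  ∑ i ∈ Finset.range (2 * k), edgeLen ρ n (x (i : ℤ)) (x ((i : ℤ) + 1))


open Real

/-- A function increasing by one along each covering relation of a finite poset is strictly
monotone. -/
lemma strictMono_of_covBy_add_one {P : Type*} [PartialOrder P] [Finite P] {ρ : P → ℕ}
    (hcov : ∀ a b : P, a ⋖ b → ρ b = ρ a + 1) : StrictMono ρ := by
  classical
  have := Fintype.ofFinite P
  let _ : LocallyFiniteOrder P := Fintype.toLocallyFiniteOrder
  refine (strictMono_iff_forall_covBy ρ).2 fun a b h => ?_
  rw [hcov a b h]
  exact Nat.lt_succ_self _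

lemma ComplementsIn.eq_sup {P : Type*} [Lattice P] {z w x y : P} (h : ComplementsIn z w x y) :
    w = x ⊔ y :=
  (h.2.2.2.2.1 _ (h.1.trans le_sup_left) (sup_le h.2.1 h.2.2.2.1) le_sup_left le_sup_right).symm

lemma edgeLen_comm {P : Type*} [Lattice P] (ρ : P → ℕ) (n : ℕ) (a b : P) :
    edgeLen ρ n a b = edgeLen ρ n b a := by
  simp only [edgeLen, inf_comm, sup_comm]

lemma edgeLen_of_le {P : Type*} [Lattice P] (ρ : P → ℕ) (n : ℕ) {a b : P} (h : a ≤ b) :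
    edgeLen ρ n a b =
      arccos √(((ρ a : ℝ) * ((n : ℝ) - ρ b)) / ((ρ b : ℝ) * ((n : ℝ) - ρ a))) := by
  simp only [edgeLen, inf_eq_left.2 h, sup_eq_right.2 h]

lemma arccos_sqrt_one_ninth : arccos √(1 / 9) = π - 2 * arccos √(1 / 3) := by
  have h9 : √(1 / 9 : ℝ) = 1 / 3 := by
    rw [show (1 / 9 : ℝ) = (1 / 3) ^ 2 by norm_num]
    exact sqrt_sq (by norm_num)
  have h3 : √(1 / 3 : ℝ) ≤ 1 := sqrt_le_one.2 (by norm_num)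
  have hcos : cos (2 * arccos √(1 / 3)) = -(1 / 3) := by
    rw [cos_two_mul, cos_arccos (by linarith [sqrt_nonneg (1 / 3 : ℝ)]) h3,
      sq_sqrt (by norm_num)]
    norm_num
  have h := arccos_cos (x := 2 * arccos √(1 / 3))
    (by linarith [arccos_nonneg √(1 / 3)])
    (by linarith [arccos_le_pi_div_two.2 (sqrt_nonneg (1 / 3 : ℝ))])
  rw [hcos, arccos_neg] at h
  rw [h9]
  linarith

lemma arccos_sqrt_one_third_le : 3 * arccos √(1 / 3) ≤ π := by
  have h : arccos √(1 / 3) ≤ arccos √(1 / 9) :=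
    antitone_arccos (sqrt_le_sqrt (by norm_num))
  linarith [arccos_sqrt_one_ninth]

lemma pi_div_four_le_arccos_sqrt_one_third : π / 4 ≤ arccos √(1 / 3) := by
  linarith [arccos_sqrt_one_ninth, arccos_le_pi_div_two.2 (sqrt_nonneg (1 / 9 : ℝ))]

lemma edgeLen_rank_three {P : Type*} [Lattice P] {ρ : P → ℕ} {a b : P} (h : a ≤ b)
    (ha : ρ a = 1) (hb : ρ b = 2) : edgeLen ρ 3 a b = π / 3 := by
  rw [edgeLen_of_le ρ 3 h, ha, hb]
  have h4 : √(((1 : ℕ) * (((3 : ℕ) : ℝ) - (2 : ℕ))) / ((2 : ℕ) * (((3 : ℕ) : ℝ) - (1 : ℕ))))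
      = cos (π / 3) := by
    rw [cos_pi_div_three, show ((1 : ℕ) * (((3 : ℕ) : ℝ) - (2 : ℕ))) /
      ((2 : ℕ) * (((3 : ℕ) : ℝ) - (1 : ℕ))) = (1 / 2) ^ 2 by norm_num]
    exact sqrt_sq (by norm_num)
  rw [h4]
  exact arccos_cos (by positivity) (by linarith [pi_pos])

/-- In rank four, an edge has length `arccos √(1/3)` if it joins adjacent ranks and
`π - 2 arccos √(1/3)` if it joins ranks one and three. -/
lemma edgeLen_rank_four {P : Type*} [Lattice P] {ρ : P → ℕ} {a b : P} {d : ℕ} (h : a ≤ b)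
    (ha : 0 < ρ a) (hb : ρ b < 4) (hd : ρ b = ρ a + 1 + d) :
    edgeLen ρ 4 a b = arccos √(1 / 3) + d * (π - 3 * arccos √(1 / 3)) := by
  have hcases : (ρ a = 1 ∧ ρ b = 2 ∧ d = 0) ∨ (ρ a = 2 ∧ ρ b = 3 ∧ d = 0) ∨
      (ρ a = 1 ∧ ρ b = 3 ∧ d = 1) := by omega
  rw [edgeLen_of_le ρ 4 h]
  rcases hcases with ⟨h1, h2, rfl⟩ | ⟨h1, h2, rfl⟩ | ⟨h1, h2, rfl⟩
  · rw [h1, h2]; norm_num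
  · rw [h1, h2]; norm_num
  · rw [h1, h2, show (((1 : ℕ) : ℝ) * (((4 : ℕ) : ℝ) - (3 : ℕ))) /
      ((3 : ℕ) * (((4 : ℕ) : ℝ) - (1 : ℕ))) = 1 / 9 by norm_num, arccos_sqrt_one_ninth]
    push_cast
    ring

lemma IsSpindleIn.alternating {P : Type*} [PartialOrder P] {z w : P} {k : ℕ} {x : ℤ → P}
    (hx : IsSpindleIn z w k x) :
    (∀ i, (Even i → x (i + 1) ≤ x i) ∧ (Odd i → x i ≤ x (i + 1))) ∨
      ∀ i, (Odd i → x (i + 1) ≤ x i) ∧ (Even i → x i ≤ x (i + 1)) := by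
  obtain ⟨-, -, -, -, ⟨h1, h2⟩ | ⟨h1, h2⟩⟩ := hx
  · exact .inl fun i => ⟨fun hi => (h1 i hi).2.2.2.1, fun hi => (h2 i hi).2.2.1⟩
  · exact .inr fun i => ⟨fun hi => (h1 i hi).2.2.2.1, fun hi => (h2 i hi).2.2.1⟩

lemma IsSpindleIn.ne_succ {P : Type*} [PartialOrder P] {z w : P} {k : ℕ} {x : ℤ → P}
    (hx : IsSpindleIn z w k x) {i : ℤ} (h0 : 0 ≤ i) (hi : i < 2 * k) : x i ≠ x (i + 1) := by
  obtain ⟨hk, hper, hinj, -⟩ := hx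
  intro h
  rcases (show i + 1 < 2 * k ∨ i + 1 = 0 + 2 * k by omega) with h1 | h1
  · have := hinj i (i + 1) h0 hi (by omega) h1 h
    omega
  · rw [h1, hper] at h
    have := hinj i 0 h0 hi le_rfl (by omega) h
    omega

/-- A lattice has no spindles of girth four. -/
lemma IsSpindleIn.three_le {P : Type*} [Lattice P] {z w : P} {k : ℕ} {x : ℤ → P}
    (hx : IsSpindleIn z w k x) : 3 ≤ k := by
  obtain ⟨hk, hper, hinj, -, h⟩ := hx
  by_contra! hlt
  obtain rfl : k = 2 := by omega
  rcases h with ⟨h, -⟩ | ⟨h, -⟩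
  · have e0 := (h 0 (by decide)).eq_sup
    have e2 := (h 2 (by decide)).eq_sup
    have hp := hper (-1)
    norm_num at e0 e2 hp
    rw [hp, sup_comm] at e2
    have := hinj 0 2 (by norm_num) (by norm_num) (by norm_num) (by norm_num)
      (by rw [e0, e2])
    omega
  · have e1 := (h 1 (by decide)).eq_sup
    have e3 := (h 3 (by decide)).eq_sup
    have hp := hper 0
    norm_num at e1 e3 hp
    have := hinj 1 3 (by norm_num) (by norm_num) (by norm_num) (by norm_num)
      (by rw [e1, e3, hp, sup_comm])
    omega

/-- In a finite bounded graded lattice of rank `n ≤ 4`, if there is a short global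
spindle (one of length less than `2π`), then `n = 4`, the spindle has girth exactly
`6`, and there is an `r ∈ {1, 2}` such that the ranks of the spindle elements
alternate between `r` and `r + 1` around the spindle. -/
theorem short_spindles_low_rank {P : Type*} [Lattice P] [BoundedOrder P] [Fintype P]
    (n : ℕ) (hn : n ≤ 4) (ρ : P → ℕ) (hbot : ρ ⊥ = 0) (htop : ρ ⊤ = n)
    (hcov : ∀ a b : P, a ⋖ b → ρ b = ρ a + 1)
    (k : ℕ) (x : ℤ → P) (hx : IsSpindleIn (⊥ : P) ⊤ k x)
    (hshort : spindleLength ρ n k x < 2 * Real.pi) :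
    n = 4 ∧ k = 3 ∧ ∃ r : ℕ, (r = 1 ∨ r = 2) ∧
      ∀ i : ℤ, (ρ (x i) = r ∧ ρ (x (i + 1)) = r + 1) ∨
        (ρ (x i) = r + 1 ∧ ρ (x (i + 1)) = r) := by
  have hmono : StrictMono ρ := strictMono_of_covBy_add_one hcov
  have hk3 := hx.three_le
  have hpos : ∀ i, 0 < ρ (x i) := fun i =>
    hbot ▸ hmono (bot_lt_iff_ne_bot.2 (hx.2.2.2.1 i).2.2.1)
  have hlt : ∀ i, ρ (x i) < n := fun i =>
    htop ▸ hmono (lt_top_iff_ne_top.2 (hx.2.2.2.1 i).2.2.2)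
  have hedge : ∀ i : ℤ, 0 ≤ i → i < 2 * k → x i < x (i + 1) ∨ x (i + 1) < x i := by
    intro i h0 hi
    have hne := hx.ne_succ h0 hi
    rcases Int.even_or_odd i with he | ho <;> rcases hx.alternating with h | h
    · exact .inr (((h i).1 he).lt_of_ne hne.symm)
    · exact .inl (((h i).2 he).lt_of_ne hne)
    · exact .inl (((h i).2 ho).lt_of_ne hne)
    · exact .inr (((h i).1 ho).lt_of_ne hne.symm)
  have hn34 : n = 3 ∨ n = 4 := by
    have := hpos 0
    have := hpos (0 + 1)
    have := hlt 0
    have := hlt (0 + 1)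
    rcases hedge 0 le_rfl (by omega) with h | h <;> have := hmono h <;> omega
  have hk3' : (3 : ℝ) ≤ k := by exact_mod_cast hk3
  rcases hn34 with rfl | rfl
  · have hlen : spindleLength ρ 3 k x = 2 * k * (π / 3) := by
      rw [spindleLength, Finset.sum_congr rfl (g := fun _ => π / 3)]
      · simp
      intro i hi
      have hi' := Finset.mem_range.1 hi
      have h1 := hpos i
      have h2 := hpos (i + 1)
      have h3 := hlt i
      have h4 := hlt (i + 1)
      rcases hedge i (by omega) (by omega) with h | h
      · have := hmono h
        exact edgeLen_rank_three h.le (by omega) (by omega)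
      · have := hmono h
        rw [edgeLen_comm]
        exact edgeLen_rank_three h.le (by omega) (by omega)
    rw [hlen] at hshort
    nlinarith [pi_pos]
  have hα := arccos_sqrt_one_third_le
  have hlength : ∀ i : ℤ, 0 ≤ i → i < 2 * k → ∃ d : ℕ,
      (ρ (x (i + 1)) = ρ (x i) + 1 + d ∨ ρ (x i) = ρ (x (i + 1)) + 1 + d) ∧
      edgeLen ρ 4 (x i) (x (i + 1)) = arccos √(1 / 3) + d * (π - 3 * arccos √(1 / 3)) := by
    intro i h0 hi
    rcases hedge i h0 hi with h | h
    · obtain ⟨d, hd⟩ := Nat.exists_eq_add_of_lt (hmono h)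
      have hd' : ρ (x (i + 1)) = ρ (x i) + 1 + d := by omega
      exact ⟨d, .inl hd', edgeLen_rank_four h.le (hpos i) (hlt _) hd'⟩
    · obtain ⟨d, hd⟩ := Nat.exists_eq_add_of_lt (hmono h)
      have hd' : ρ (x i) = ρ (x (i + 1)) + 1 + d := by omega
      exact ⟨d, .inr hd', (edgeLen_comm ρ 4 _ _).trans
        (edgeLen_rank_four h.le (hpos _) (hlt _) hd')⟩
  obtain rfl : k = 3 := by
    by_contra hne
    have hk4 : (4 : ℝ) ≤ k := by exact_mod_cast (show 4 ≤ k by omega)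
    have hle : (2 * k : ℝ) * (π / 4) ≤ spindleLength ρ 4 k x := by
      have := Finset.card_nsmul_le_sum (Finset.range (2 * k))
        (fun i : ℕ => edgeLen ρ 4 (x (i : ℤ)) (x ((i : ℤ) + 1))) (π / 4) (by
          intro i hi
          have hi' := Finset.mem_range.1 hi
          obtain ⟨d, -, hd⟩ := hlength i (by omega) (by omega)
          rw [hd]
          nlinarith [pi_div_four_le_arccos_sqrt_one_third, (Nat.cast_nonneg d : (0 : ℝ) ≤ d)])
      simpa [spindleLength] using this
    nlinarith [pi_pos]
  obtain ⟨d0, c0, e0⟩ := hlength 0 (by norm_num) (by norm_num)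
  obtain ⟨d1, c1, e1⟩ := hlength 1 (by norm_num) (by norm_num)
  obtain ⟨d2, c2, e2⟩ := hlength 2 (by norm_num) (by norm_num)
  obtain ⟨d3, c3, e3⟩ := hlength 3 (by norm_num) (by norm_num)
  obtain ⟨d4, c4, e4⟩ := hlength 4 (by norm_num) (by norm_num)
  obtain ⟨d5, c5, e5⟩ := hlength 5 (by norm_num) (by norm_num)
  have hper : ∀ i, x (i + 6) = x i := fun i => by simpa using hx.2.1 i
  have h6 : x 6 = x 0 := hper 0
  norm_num at c0 c1 c2 c3 c4 c5 e0 e1 e2 e3 e4 e5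
  rw [h6] at c5 e5
  have hd : d0 + d1 + d2 + d3 + d4 + d5 < 2 := by
    by_contra! hge
    have hge' : (2 : ℝ) ≤ d0 + d1 + d2 + d3 + d4 + d5 := by exact_mod_cast hge
    simp only [spindleLength, Finset.sum_range_succ, Finset.sum_range_zero] at hshort
    norm_num [h6, e0, e1, e2, e3, e4, e5] at hshort
    norm_num at hα
    nlinarith
  have hmod : ∀ i, x i = x (i % 6) := fun i => by
    have hp : Function.Periodic x 6 := hper
    conv_lhs => rw [← Int.emod_add_mul_ediv i 6, mul_comm]
    simpa using hp.int_mul (i / 6) (i % 6)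
  have hall : ∀ r, (∀ j : ℤ, 0 ≤ j → j < 6 → (ρ (x j) = r ∧ ρ (x (j + 1)) = r + 1) ∨
      (ρ (x j) = r + 1 ∧ ρ (x (j + 1)) = r)) → ∀ i : ℤ,
      (ρ (x i) = r ∧ ρ (x (i + 1)) = r + 1) ∨ (ρ (x i) = r + 1 ∧ ρ (x (i + 1)) = r) := by
    intro r h i
    have hsucc : x (i + 1) = x (i % 6 + 1) := by
      rw [hmod (i + 1), ← Int.emod_add_emod, ← hmod]
    rw [hmod i, hsucc]
    exact h _ (Int.emod_nonneg _ (by norm_num)) (Int.emod_lt_of_pos _ (by norm_num))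
  have := hpos 0
  have := hpos 1
  have := hlt 0
  have := hlt 1
  refine ⟨rfl, rfl, min (ρ (x 0)) (ρ (x 1)), by omega, hall _ fun j hj0 hj6 => ?_⟩
  have hcyc : (ρ (x 1) ≤ ρ (x 0) ∧ ρ (x 1) ≤ ρ (x 2) ∧ ρ (x 3) ≤ ρ (x 2) ∧ ρ (x 3) ≤ ρ (x 4) ∧
      ρ (x 5) ≤ ρ (x 4) ∧ ρ (x 5) ≤ ρ (x 0)) ∨
      (ρ (x 0) ≤ ρ (x 1) ∧ ρ (x 2) ≤ ρ (x 1) ∧ ρ (x 2) ≤ ρ (x 3) ∧ ρ (x 4) ≤ ρ (x 3) ∧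
      ρ (x 4) ≤ ρ (x 5) ∧ ρ (x 0) ≤ ρ (x 5)) := by
    have hm := hmono.monotone
    rcases hx.alternating with h | h
    · exact .inl ⟨hm ((h 0).1 (by decide)), hm ((h 1).2 (by decide)), hm ((h 2).1 (by decide)),
        hm ((h 3).2 (by decide)), hm ((h 4).1 (by decide)), h6 ▸ hm ((h 5).2 (by decide))⟩
    · exact .inr ⟨hm ((h 0).2 (by decide)), hm ((h 1).1 (by decide)), hm ((h 2).2 (by decide)),
        hm ((h 3).1 (by decide)), hm ((h 4).2 (by decide)), h6 ▸ hm ((h 5).1 (by decide))⟩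
  interval_cases j <;> norm_num [h6] <;> omega
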